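/- Let (W,S) be a Coxeter system with length function ℓ and Bruhat order ≤. Then there exists a function ε assigning a sign ε(x,y) ∈ {+1, −1} to every Carter–Payne pair (x,y) (i.e. y ≤ x with ℓ(y) = ℓ(x) − 1) such that for every diamond — that is, every quadruple (w, x₁, x₂, z) with x₁ ≠ x₂, ℓ(w) = ℓ(z) + 2, and z ≤ x₁ ≤ w, z ≤ x₂ ≤ w with ℓ(x₁) = ℓ(x₂) = ℓ(z) + 1 — the product of the four signs satisfies ε(w,x₁)·ε(x₁,z)·ε(w,x₂)·ε(x₂,z) = −1. -/

import Mathlib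

/-- The Bruhat order on a Coxeter group: `y ≤ w` iff some reduced expression of `w` admits a
subword which is a reduced expression for `y`. -/
def CoxeterSystem.BruhatLE {B : Type*} {W : Type*} [Group W] {M : CoxeterMatrix B}
    (cs : CoxeterSystem M W) (y w : W) : Prop :=
  ∃ ω : List B, cs.IsReduced ω ∧ cs.wordProd ω = w ∧
    ∃ ω' : List B, ω'.Sublist ω ∧ cs.IsReduced ω' ∧ cs.wordProd ω' = y

namespace CoxeterSystem

variable {B : Type*} {W : Type*} [Group W] {M : CoxeterMatrix B} (cs : CoxeterSystem M W)

open scoped Classical in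
/-- The involution of `W × ZMod 2` which conjugates the first component by the simple reflection
`s i` and flips the second component exactly when the first one is `s i`. -/
noncomputable def signedConj (i : B) : Equiv.Perm (W × ZMod 2) :=
  Function.Involutive.toPerm
    (fun p ↦ (cs.simple i * p.1 * cs.simple i, p.2 + if p.1 = cs.simple i then 1 else 0)) <| by
    rintro ⟨t, z⟩
    have h : cs.simple i * t * cs.simple i = cs.simple i ↔ t = cs.simple i := by
      constructor
      · intro h
        simpa [mul_assoc] using congrArg (fun u ↦ cs.simple i * u * cs.simple i) h
      · rintro rfl
        simp
    ext
    · simp [mul_assoc]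
    · simp only [h, add_assoc, CharTwo.add_self_eq_zero, add_zero]

open scoped Classical in
theorem signedConj_apply (i : B) (t : W) (z : ZMod 2) :
    cs.signedConj i (t, z) =
      (cs.simple i * t * cs.simple i, z + if t = cs.simple i then 1 else 0) :=
  rfl

theorem pow_mul_simple (i j : B) (n : ℕ) :
    (cs.simple i * cs.simple j) ^ n * cs.simple j =
      cs.simple j * ((cs.simple i * cs.simple j) ^ n)⁻¹ := by
  have h : SemiconjBy (cs.simple j) (cs.simple i * cs.simple j)⁻¹ (cs.simple i * cs.simple j) := by
    simp [SemiconjBy, mul_assoc]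
  rw [← inv_pow]
  exact (h.pow_right n).eq.symm

open scoped Classical in
theorem signedConj_mul_pow_apply (i j : B) (n : ℕ) (t : W) (z : ZMod 2) :
    ((cs.signedConj i * cs.signedConj j) ^ n) (t, z) =
      ((cs.simple i * cs.simple j) ^ n * t * ((cs.simple i * cs.simple j) ^ n)⁻¹,
        z + ∑ l ∈ Finset.range (2 * n),
          if t = cs.simple j * (cs.simple i * cs.simple j) ^ l then 1 else 0) := by
  induction n with
  | zero => simp
  | succ n ih =>
    set r := cs.simple i * cs.simple j with hr
    have hn : r ^ n * cs.simple j = cs.simple j * (r ^ n)⁻¹ := cs.pow_mul_simple i j n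
    have hn' : (r ^ n)⁻¹ * cs.simple j = cs.simple j * r ^ n := by
      rw [inv_mul_eq_iff_eq_mul, ← mul_assoc, hn, mul_assoc, inv_mul_cancel, mul_one]
    have h₀ : r ^ n * t * (r ^ n)⁻¹ = cs.simple j ↔ t = cs.simple j * r ^ (2 * n) := by
      rw [mul_inv_eq_iff_eq_mul, ← eq_inv_mul_iff_mul_eq, ← mul_assoc, hn', mul_assoc, ← pow_add,
        two_mul]
    have h₁ : cs.simple j * (r ^ n * t * (r ^ n)⁻¹) * cs.simple j = cs.simple i ↔
        t = cs.simple j * r ^ (2 * n + 1) := by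
      have e (u : W) : cs.simple j * u * cs.simple j = cs.simple i ↔ u = cs.simple j * r := by
        rw [hr]
        constructor
        · intro h
          rw [← h]
          simp [mul_assoc]
        · rintro rfl
          simp [mul_assoc]
      rw [e, mul_inv_eq_iff_eq_mul, ← eq_inv_mul_iff_mul_eq, ← mul_assoc, ← mul_assoc, hn',
        mul_assoc, mul_assoc, ← pow_succ', ← pow_add]
      ring_nf
    rw [pow_succ', Equiv.Perm.mul_apply, ih, Equiv.Perm.mul_apply, signedConj_apply,
      signedConj_apply]
    ext
    · rw [pow_succ' r]
      simp [hr, mul_assoc]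
    · simp only [h₀, h₁, mul_add, mul_one, Finset.sum_range_succ, add_assoc]

theorem isLiftable_signedConj : M.IsLiftable cs.signedConj := by
  classical
  intro i j
  ext ⟨t, z⟩ : 1
  have h : (cs.simple i * cs.simple j) ^ M i j = 1 := cs.simple_mul_simple_pow i j
  rw [signedConj_mul_pow_apply, two_mul, Finset.sum_range_add]
  simp only [pow_add, h, one_mul, inv_one, mul_one, CharTwo.add_self_eq_zero, add_zero,
    Equiv.Perm.one_apply]

/-- The action of a Coxeter group on `W × ZMod 2` in which the simple reflection `s i` acts by
`signedConj i`. -/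
noncomputable def signedConjHom : W →* Equiv.Perm (W × ZMod 2) :=
  cs.lift ⟨cs.signedConj, cs.isLiftable_signedConj⟩

theorem signedConjHom_simple (i : B) : cs.signedConjHom (cs.simple i) = cs.signedConj i :=
  cs.lift_apply_simple cs.isLiftable_signedConj i

open scoped Classical in
theorem signedConjHom_wordProd (ω : List B) (t : W) (z : ZMod 2) :
    cs.signedConjHom (cs.wordProd ω) (t, z) =
      (cs.wordProd ω * t * (cs.wordProd ω)⁻¹, z + (cs.rightInvSeq ω).count t) := by
  induction ω with
  | nil => simp
  | cons i ω ih =>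
    have h : cs.wordProd ω * t * (cs.wordProd ω)⁻¹ = cs.simple i ↔
        (cs.wordProd ω)⁻¹ * cs.simple i * cs.wordProd ω = t := by
      rw [mul_inv_eq_iff_eq_mul, ← eq_inv_mul_iff_mul_eq, eq_comm, mul_assoc]
    rw [wordProd_cons, map_mul, Equiv.Perm.mul_apply, ih, signedConjHom_simple, signedConj_apply]
    ext
    · simp [mul_assoc]
    · simp [rightInvSeq, List.count_cons, h, add_assoc]

/-- The number modulo 2 of occurrences of `t` in the right inversion sequence of a word
for `w`. -/
noncomputable def inversionParity (w t : W) : ZMod 2 := (cs.signedConjHom w (t, 0)).2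

theorem signedConjHom_apply (w t : W) (z : ZMod 2) :
    cs.signedConjHom w (t, z) = (w * t * w⁻¹, z + cs.inversionParity w t) := by
  classical
  obtain ⟨ω, rfl⟩ := cs.wordProd_surjective w
  simp [inversionParity, signedConjHom_wordProd]

theorem inversionParity_mul (u v t : W) :
    cs.inversionParity (u * v) t =
      cs.inversionParity v t + cs.inversionParity u (v * t * v⁻¹) := by
  have h : cs.signedConjHom (u * v) (t, 0) = cs.signedConjHom u (cs.signedConjHom v (t, 0)) := by
    rw [map_mul, Equiv.Perm.mul_apply]
  simpa only [signedConjHom_apply, zero_add] using congrArg Prod.snd h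

open scoped Classical in
theorem inversionParity_simple (i : B) (t : W) :
    cs.inversionParity (cs.simple i) t = if t = cs.simple i then 1 else 0 := by
  simp [inversionParity, signedConjHom_simple, signedConj_apply]

theorem IsReflection.inversionParity_self {t : W} (ht : cs.IsReflection t) :
    cs.inversionParity t t = 1 := by
  obtain ⟨w, i, rfl⟩ := ht
  have h := cs.inversionParity_mul w w⁻¹ (w * cs.simple i * w⁻¹)
  have h₁ : cs.inversionParity 1 (w * cs.simple i * w⁻¹) = 0 := by simp [inversionParity]
  have e : w⁻¹ * (w * cs.simple i * w⁻¹) * w⁻¹⁻¹ = cs.simple i := by group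
  rw [mul_inv_cancel, h₁, e] at h
  rw [inversionParity_mul, inversionParity_mul, e, inversionParity_simple, if_pos rfl,
    mul_inv_cancel_right, add_left_comm, ← h, add_zero]

theorem isRightInversion_of_inversionParity_ne_zero {w t : W} (h : cs.inversionParity w t ≠ 0) :
    cs.IsRightInversion w t := by
  classical
  obtain ⟨ω, hω, rfl⟩ := cs.exists_isReduced w
  refine cs.isRightInversion_of_mem_rightInvSeq hω (by_contra fun hn ↦ h ?_)
  simp [inversionParity, signedConjHom_wordProd, List.count_eq_zero_of_not_mem hn]

/-- The strong exchange condition, in terms of parities of inversions. -/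
theorem isRightInversion_iff_inversionParity_ne_zero {w t : W} :
    cs.IsRightInversion w t ↔ cs.inversionParity w t ≠ 0 := by
  refine ⟨fun ⟨ht, hlt⟩ h₀ ↦ ?_, cs.isRightInversion_of_inversionParity_ne_zero⟩
  have h : cs.inversionParity (w * t) t ≠ 0 := by
    simp [inversionParity_mul, ht.inversionParity_self, h₀]
  have := (cs.isRightInversion_of_inversionParity_ne_zero h).2
  rw [mul_assoc, ht.mul_self, mul_one] at this
  omega

theorem IsRightInversion.mul_simple {w t : W} (h : cs.IsRightInversion w t) {i : B}
    (hi : t ≠ cs.simple i) :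
    cs.IsRightInversion (w * cs.simple i) (cs.simple i * t * cs.simple i) := by
  rw [isRightInversion_iff_inversionParity_ne_zero] at h ⊢
  have := cs.inversionParity_mul (w * cs.simple i) (cs.simple i) t
  rw [simple_mul_simple_cancel_right, inversionParity_simple, if_neg hi, zero_add,
    inv_simple] at this
  rwa [← this]

/-- `cs.BruhatCovers w x` says that `x` is obtained from `w` by multiplication by a reflection and
has length one less than `w`. -/
def BruhatCovers (w x : W) : Prop :=
  cs.length w = cs.length x + 1 ∧ ∃ t, cs.IsReflection t ∧ x = w * t

theorem exists_isReflection_of_sublist {ω' ω : List B} (h : ω'.Sublist ω)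
    (hl : ω.length = ω'.length + 1) :
    ∃ t, cs.IsReflection t ∧ cs.wordProd ω' = cs.wordProd ω * t := by
  induction h with
  | slnil => simp at hl
  | @cons l₁ l₂ i h ih =>
    obtain rfl : l₁ = l₂ := h.eq_of_length (by simpa using hl.symm)
    refine ⟨(cs.wordProd l₁)⁻¹ * cs.simple i * cs.wordProd l₁,
      ⟨(cs.wordProd l₁)⁻¹, i, by simp⟩, ?_⟩
    simp [wordProd_cons, mul_assoc]
  | @cons_cons l₁ l₂ i h ih =>
    obtain ⟨t, ht, e⟩ := ih (by simpa using hl)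
    exact ⟨t, ht, by rw [wordProd_cons, wordProd_cons, e, mul_assoc]⟩

theorem BruhatLE.bruhatCovers {w x : W} (h : cs.BruhatLE x w)
    (hl : cs.length w = cs.length x + 1) : cs.BruhatCovers w x := by
  obtain ⟨ω, hω, rfl, ω', hs, hω', rfl⟩ := h
  exact ⟨hl, cs.exists_isReflection_of_sublist hs (by rw [← hω.eq, ← hω'.eq, hl])⟩

theorem IsRightDescent.bruhatCovers {w : W} {i : B} (h : cs.IsRightDescent w i) :
    cs.BruhatCovers w (w * cs.simple i) :=
  ⟨(cs.isRightDescent_iff.1 h).symm, _, cs.isReflection_simple i, rfl⟩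

/-- The lifting property of the Bruhat order, for covers. -/
theorem BruhatCovers.lift {w x : W} (h : cs.BruhatCovers w x) {i : B}
    (hi : cs.IsRightDescent w i) (hx : x ≠ w * cs.simple i) :
    cs.IsRightDescent x i ∧ cs.BruhatCovers (w * cs.simple i) (x * cs.simple i) := by
  obtain ⟨hl, t, ht, rfl⟩ := h
  have hne : t ≠ cs.simple i := fun h ↦ hx (by rw [h])
  have hinv : cs.IsRightInversion w t := ⟨ht, by omega⟩
  obtain ⟨ht', hlt⟩ := hinv.mul_simple cs hne
  have e : w * cs.simple i * (cs.simple i * t * cs.simple i) = w * t * cs.simple i := by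
    simp [mul_assoc]
  rw [e] at hlt
  have h₁ := cs.isRightDescent_iff.1 hi
  have h₂ := cs.length_mul_simple (w * t) i
  exact ⟨cs.isRightDescent_iff.2 (by omega), by omega, _, ht', e.symm⟩

open scoped Classical in
/-- Signs on Bruhat covers: given a right descent `i` of `w`, the cover `(w, w * s i)` has sign `1`,
and the sign of any other cover `(w, x)` is the one forced by the diamond
`(w, w * s i, x, x * s i)`. -/
noncomputable def bruhatSign (w x : W) : ℤ :=
  if h : (∃ i, cs.IsRightDescent w i) ∧ cs.length x < cs.length w then
    if x = w * cs.simple h.1.choose then 1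
    else -(bruhatSign (w * cs.simple h.1.choose) (x * cs.simple h.1.choose) *
      bruhatSign x (x * cs.simple h.1.choose))
  else 1
termination_by cs.length w
decreasing_by
  · exact h.1.choose_spec
  · exact h.2

theorem bruhatSign_mul_self (w x : W) : cs.bruhatSign w x * cs.bruhatSign w x = 1 := by
  rw [bruhatSign]
  split_ifs with h h'
  · rfl
  · have h₁ := bruhatSign_mul_self (w * cs.simple h.1.choose) (x * cs.simple h.1.choose)
    have h₂ := bruhatSign_mul_self x (x * cs.simple h.1.choose)
    rw [neg_mul_neg, mul_mul_mul_comm, h₁, h₂, one_mul]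
  · rfl
termination_by cs.length w
decreasing_by
  · exact h.1.choose_spec
  · exact h.2

/-- Around the diamonds through a suitable right multiple `w * s i`, the four signs have
product `-1`. -/
theorem exists_isRightDescent_bruhatSign {w : W} (hw : w ≠ 1) :
    ∃ i, cs.IsRightDescent w i ∧ cs.bruhatSign w (w * cs.simple i) = 1 ∧
      ∀ x, x ≠ w * cs.simple i → cs.length x < cs.length w →
        cs.bruhatSign w x =
          -(cs.bruhatSign (w * cs.simple i) (x * cs.simple i) *
            cs.bruhatSign x (x * cs.simple i)) := by
  have h := cs.exists_rightDescent_of_ne_one hw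
  refine ⟨h.choose, h.choose_spec, ?_, fun x hx hl ↦ ?_⟩
  · rw [bruhatSign, dif_pos ⟨h, h.choose_spec⟩, if_pos rfl]
  · rw [bruhatSign, dif_pos ⟨h, hl⟩, if_neg hx]

theorem bruhatSign_diamond {w x₁ x₂ z : W} (hne : x₁ ≠ x₂) (h₁ : cs.BruhatCovers w x₁)
    (h₂ : cs.BruhatCovers w x₂) (h₁z : cs.BruhatCovers x₁ z) (h₂z : cs.BruhatCovers x₂ z) :
    cs.bruhatSign w x₁ * cs.bruhatSign x₁ z * cs.bruhatSign w x₂ * cs.bruhatSign x₂ z = -1 := by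
  induction hn : cs.length w using Nat.strong_induction_on generalizing w x₁ x₂ z with
  | _ n ih =>
  subst hn
  have hl₁ := h₁.1
  have hl₂ := h₂.1
  have hw : w ≠ 1 := by
    rintro rfl
    simp at hl₁
  obtain ⟨i, hi, hs, hsx⟩ := cs.exists_isRightDescent_bruhatSign hw
  have inj : ∀ {a b : W}, a ≠ b → a * cs.simple i ≠ b * cs.simple i :=
    fun h h' ↦ h (mul_right_cancel h')
  have sq := cs.bruhatSign_mul_self
  -- A diamond one of whose middle elements is `w * s i`.
  have key : ∀ {x}, x ≠ w * cs.simple i → cs.BruhatCovers w x → cs.BruhatCovers x z →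
      cs.BruhatCovers (w * cs.simple i) z →
      cs.bruhatSign (w * cs.simple i) z * cs.bruhatSign w x * cs.bruhatSign x z = -1 := by
    intro x hx hwx hxz hwz
    obtain ⟨hxi, hx'⟩ := hwx.lift cs hi hx
    have hlx := hwx.1
    rw [hsx x hx (by omega)]
    by_cases hz : z = x * cs.simple i
    · subst hz
      linear_combination
        -(cs.bruhatSign x (x * cs.simple i) ^ 2) * sq (w * cs.simple i) (x * cs.simple i) -
          sq x (x * cs.simple i)
    · obtain ⟨hzi, hz'⟩ := hxz.lift cs hxi hz
      have d₁ := ih _ hi (Ne.symm hz) hx' hwz hz' (hzi.bruhatCovers cs) rfl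
      have d₂ := ih _ (by omega) (Ne.symm hz) (hxi.bruhatCovers cs) hxz hz' (hzi.bruhatCovers cs) rfl
      have q₁ := sq (x * cs.simple i) (z * cs.simple i)
      have q₂ := sq z (z * cs.simple i)
      generalize cs.bruhatSign (x * cs.simple i) (z * cs.simple i) = a at *
      generalize cs.bruhatSign z (z * cs.simple i) = b at *
      generalize cs.bruhatSign (w * cs.simple i) (x * cs.simple i) = c at *
      generalize cs.bruhatSign (w * cs.simple i) z = d at *
      generalize cs.bruhatSign x (x * cs.simple i) = e at *
      generalize cs.bruhatSign x z = f at *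
      have p : (a * a) * (b * b) * (c * d * e * f) = 1 := by
        linear_combination (e * a * f * b) * d₁ - d₂
      rw [q₁, q₂] at p
      linear_combination -p
  by_cases e₁ : x₁ = w * cs.simple i
  · subst e₁
    have := key hne.symm h₂ h₂z h₁z
    rw [hs]
    linear_combination this
  by_cases e₂ : x₂ = w * cs.simple i
  · subst e₂
    have := key hne h₁ h₁z h₂z
    rw [hs]
    linear_combination this
  obtain ⟨hi₁, hx₁⟩ := h₁.lift cs hi e₁
  obtain ⟨hi₂, hx₂⟩ := h₂.lift cs hi e₂
  have not_descent : ∀ {x}, cs.IsRightDescent x i → ¬ cs.IsRightDescent (x * cs.simple i) i :=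
    fun h ↦ cs.isRightDescent_iff_not_isRightDescent_mul.1 h
  have hz : cs.IsRightDescent z i := by
    by_contra hz
    have f₁ : z = x₁ * cs.simple i := by_contra fun h ↦ hz (h₁z.lift cs hi₁ h).1
    have f₂ : z = x₂ * cs.simple i := by_contra fun h ↦ hz (h₂z.lift cs hi₂ h).1
    exact inj hne (f₁.symm.trans f₂)
  have n₁ : z ≠ x₁ * cs.simple i := fun h ↦ not_descent hi₁ (h ▸ hz)
  have n₂ : z ≠ x₂ * cs.simple i := fun h ↦ not_descent hi₂ (h ▸ hz)
  have hz₁ := (h₁z.lift cs hi₁ n₁).2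
  have hz₂ := (h₂z.lift cs hi₂ n₂).2
  have d := ih _ hi (inj hne) hx₁ hx₂ hz₁ hz₂ rfl
  have d₁ := ih _ (by omega) n₁ h₁z (hi₁.bruhatCovers cs) (hz.bruhatCovers cs) hz₁ rfl
  have d₂ := ih _ (by omega) n₂ h₂z (hi₂.bruhatCovers cs) (hz.bruhatCovers cs) hz₂ rfl
  rw [hsx x₁ e₁ (by omega), hsx x₂ e₂ (by omega)]
  have q₁ := sq (x₁ * cs.simple i) (z * cs.simple i)
  have q₂ := sq (x₂ * cs.simple i) (z * cs.simple i)
  have q := sq z (z * cs.simple i)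
  generalize cs.bruhatSign (x₁ * cs.simple i) (z * cs.simple i) = a₁ at *
  generalize cs.bruhatSign (x₂ * cs.simple i) (z * cs.simple i) = a₂ at *
  generalize cs.bruhatSign z (z * cs.simple i) = b at *
  generalize cs.bruhatSign (w * cs.simple i) (x₁ * cs.simple i) = c₁ at *
  generalize cs.bruhatSign (w * cs.simple i) (x₂ * cs.simple i) = c₂ at *
  generalize cs.bruhatSign x₁ (x₁ * cs.simple i) = g₁ at *
  generalize cs.bruhatSign x₂ (x₂ * cs.simple i) = g₂ at *
  generalize cs.bruhatSign x₁ z = f₁ at *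
  generalize cs.bruhatSign x₂ z = f₂ at *
  have p : (a₁ * a₁) * (a₂ * a₂) * (b * b) * (c₁ * g₁ * f₁ * (c₂ * g₂ * f₂)) = -1 := by
    linear_combination (f₁ * b * g₁ * a₁) * (f₂ * b * g₂ * a₂) * d - (f₂ * b * g₂ * a₂) * d₁ + d₂
  rw [q₁, q₂, q] at p
  linear_combination p

end CoxeterSystem

/-- There is an assignment of signs `ε(x,y) ∈ {±1}` to Carter–Payne pairs
(`y ≤ x` with `ℓ(x) = ℓ(y) + 1`) such that around every diamond
`z ≤ x₁, x₂ ≤ w` (with `x₁ ≠ x₂`, `ℓ(w) = ℓ(z) + 2`, `ℓ(x₁) = ℓ(x₂) = ℓ(z) + 1`)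
the product of the four signs is `−1`. -/
theorem exists_diamond_sign_assignment {B : Type*} {W : Type*} [Group W]
    {M : CoxeterMatrix B} (cs : CoxeterSystem M W) :
    ∃ ε : W → W → ℤ,
      (∀ x y : W, cs.BruhatLE y x → cs.length x = cs.length y + 1 →
        ε x y = 1 ∨ ε x y = -1) ∧
      (∀ w x₁ x₂ z : W, x₁ ≠ x₂ →
        cs.length w = cs.length z + 2 →
        cs.length x₁ = cs.length z + 1 →
        cs.length x₂ = cs.length z + 1 →
        cs.BruhatLE x₁ w → cs.BruhatLE x₂ w →
        cs.BruhatLE z x₁ → cs.BruhatLE z x₂ →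
        ε w x₁ * ε x₁ z * ε w x₂ * ε x₂ z = -1) := by
  exact ⟨cs.bruhatSign, fun x y _ _ ↦ mul_self_eq_one_iff.1 (cs.bruhatSign_mul_self x y),
    fun w x₁ x₂ z hne hw h₁ h₂ hw₁ hw₂ hz₁ hz₂ ↦ cs.bruhatSign_diamond hne
      (hw₁.bruhatCovers cs (by omega)) (hw₂.bruhatCovers cs (by omega))
      (hz₁.bruhatCovers cs h₁) (hz₂.bruhatCovers cs h₂)⟩
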